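/- Let e_1, …, e_n ∈ ℝ^d with n ≥ 1, and suppose the matrix M of centered representations is nonzero. Then the total pairwise squared distance of the PairNorm outputs is the constant Σ_{v=1}^{n} Σ_{j=1}^{n} ‖ė_v − ė_j‖² = 2 · s² · n², independent of the input representations; in particular, the total pairwise squared distance between node representations remains unchanged across layers when PairNorm is applied after every layer. -/

import Mathlib

open scoped BigOperators

/-- The total pairwise squared distance of a finite family of vectors, in terms of their norms and
the norm of their sum. -/
theorem sum_sum_norm_sub_sq {ι E : Type*} [Fintype ι] [NormedAddCommGroup E]
    [InnerProductSpace ℝ E] (x : ι → E) :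
    ∑ v, ∑ j, ‖x v - x j‖ ^ 2
      = 2 * (Fintype.card ι : ℝ) * ∑ v, ‖x v‖ ^ 2 - 2 * ‖∑ v, x v‖ ^ 2 := by
  have h_inner : ∑ v, ∑ j, inner ℝ (x v) (x j) = ‖∑ v, x v‖ ^ 2 := by
    simp_rw [← real_inner_self_eq_norm_sq, sum_inner, inner_sum]
  simp_rw [norm_sub_sq_real, Finset.sum_add_distrib, Finset.sum_sub_distrib, ← Finset.mul_sum,
    h_inner, Finset.sum_const, Finset.card_univ, nsmul_eq_mul, ← Finset.mul_sum]
  ring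

/-- Subtracting the mean from a finite family of vectors yields a family with zero sum. -/
theorem sum_sub_mean_eq_zero {ι E : Type*} [Fintype ι] [Nonempty ι] [AddCommGroup E]
    [Module ℝ E] (x : ι → E) :
    ∑ v, (x v - (Fintype.card ι : ℝ)⁻¹ • ∑ i, x i) = 0 := by
  have h_card : (Fintype.card ι : ℝ) ≠ 0 := by exact_mod_cast Fintype.card_ne_zero
  rw [Finset.sum_sub_distrib, Finset.sum_const, Finset.card_univ, ← Nat.cast_smul_eq_nsmul ℝ,
    smul_inv_smul₀ h_card, sub_self]

/-- With PairNorm as above (nonzero centered matrix), the total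
pairwise squared distance of the outputs is the constant
`Σ_v Σ_j ‖ė v − ė j‖² = 2 · s² · n²`, independent of the input representations. -/
theorem pairNorm_total_pairwise_sq_dist (n d : ℕ) (hn : 1 ≤ n) (s : ℝ) (hs : 0 < s)
    (e m edot : Fin n → EuclideanSpace ℝ (Fin d))
    (hm : ∀ v, m v = e v - (n : ℝ)⁻¹ • ∑ i, e i)
    (hM : ∃ v, m v ≠ 0)
    (hedot : ∀ v, edot v =
      (s * Real.sqrt n / Real.sqrt (∑ v, ‖m v‖ ^ 2)) • m v) :
    ∑ v, ∑ j, ‖edot v - edot j‖ ^ 2 = 2 * s ^ 2 * (n : ℝ) ^ 2 := by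
  have : NeZero n := ⟨by omega⟩
  have h_sum : ∑ v, m v = 0 := by
    simpa [hm] using sum_sub_mean_eq_zero e
  have h_pos : 0 < ∑ v, ‖m v‖ ^ 2 := by
    obtain ⟨v, hv⟩ := hM
    exact Finset.sum_pos' (fun _ _ => by positivity) ⟨v, Finset.mem_univ v, by positivity⟩
  have h_edot_sum : ∑ v, edot v = 0 := by
    simp_rw [hedot, ← Finset.smul_sum, h_sum, smul_zero]
  have h_edot_norm : ∑ v, ‖edot v‖ ^ 2 = s ^ 2 * n := by
    simp_rw [hedot, norm_smul, mul_pow, ← Finset.mul_sum, Real.norm_eq_abs, sq_abs, div_pow,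
      mul_pow, Real.sq_sqrt h_pos.le, Real.sq_sqrt (Nat.cast_nonneg n)]
    exact div_mul_cancel₀ _ h_pos.ne'
  rw [sum_sum_norm_sub_sq, h_edot_sum, h_edot_norm, Fintype.card_fin, norm_zero]
  ring
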